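/- Let n, g be natural numbers, A ∈ ℂⁿ, B and C complex n×n matrices, D a real n×g matrix, with M = [[B_r + C_r, B_i − C_i],[B_i + C_i, −B_r + C_r]] invertible; set (U_r; U_i) = M⁻¹·(−A_r; −A_i) and W̃ = M⁻¹·[[−D, 0],[0, D]]. Let G be a real symmetric positive definite n×n matrix, g₀ ∈ ℝⁿ, and assume W̃ has full column rank. Define the loss of a generation dispatch S ∈ ℝ^{2g} as P(S) = V_rᵀ·G·V_r + V_iᵀ·G·V_i + 2·V_rᵀ·g₀ where (V_r; V_i) = (U_r; U_i) + W̃·S. Then P attains a unique global minimum over ℝ^{2g} at S* = −H⁻¹·F, where H = W̃ᵀ·diag(G, G)·W̃ and F = (W_rrᵀ·G·U_r + W_irᵀ·G·U_i + W_rrᵀ·g₀ ; W_riᵀ·G·U_r + W_iiᵀ·G·U_i + W_riᵀ·g₀) with W̃ = [[W_rr, W_ri],[W_ir, W_ii]]. -/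

import Mathlib

open scoped Matrix

namespace Matrix

theorem PosDef.fromBlocks_diagonal {m n : Type*} [Fintype m] [Fintype n]
    {A : Matrix m m ℝ} {B : Matrix n n ℝ} (hA : A.PosDef) (hB : B.PosDef) :
    (fromBlocks A 0 0 B).PosDef := by
  refine .of_dotProduct_mulVec_pos (hA.1.fromBlocks (by simp) hB.1) fun x hx => ?_
  have expand : star x ⬝ᵥ fromBlocks A 0 0 B *ᵥ x =
      star (x ∘ Sum.inl) ⬝ᵥ A *ᵥ (x ∘ Sum.inl) + star (x ∘ Sum.inr) ⬝ᵥ B *ᵥ (x ∘ Sum.inr) := by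
    rw [fromBlocks_mulVec, dotProduct_block]
    simp [Function.comp_def]
  rw [expand]
  by_cases hl : x ∘ Sum.inl = 0
  · have hr : x ∘ Sum.inr ≠ 0 := fun hr => hx <| by
      ext (i | i)
      exacts [congrFun hl i, congrFun hr i]
    exact add_pos_of_nonneg_of_pos (hA.posSemidef.dotProduct_mulVec_nonneg _)
      (hB.dotProduct_mulVec_pos hr)
  · exact add_pos_of_pos_of_nonneg (hA.dotProduct_mulVec_pos hl)
      (hB.posSemidef.dotProduct_mulVec_nonneg _)

/-- At a point where the linear form `K v + h` annihilates the direction `d ≠ 0`, the strictly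
convex quadratic `v ↦ v ⬝ᵥ K v + 2 v ⬝ᵥ h` strictly increases along `d`. -/
theorem PosDef.quadratic_lt_of_stationary {m : Type*} [Fintype m] {K : Matrix m m ℝ}
    (hK : K.PosDef) {v d h : m → ℝ} (hd : d ≠ 0) (hv : d ⬝ᵥ (K *ᵥ v + h) = 0) :
    v ⬝ᵥ K *ᵥ v + 2 * (v ⬝ᵥ h) <
      (v + d) ⬝ᵥ K *ᵥ (v + d) + 2 * ((v + d) ⬝ᵥ h) := by
  have hpos : 0 < d ⬝ᵥ K *ᵥ d := by simpa using hK.dotProduct_mulVec_pos hd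
  have hsymm : v ⬝ᵥ K *ᵥ d = d ⬝ᵥ K *ᵥ v := by
    have hKt : Kᵀ = K := by simpa [IsHermitian] using hK.1
    rw [dotProduct_mulVec, ← mulVec_transpose, hKt, dotProduct_comm]
  rw [dotProduct_add] at hv
  simp only [mulVec_add, add_dotProduct, dotProduct_add]
  linarith

theorem PosDef.quadratic_comp_affine_lt {m k : Type*} [Fintype m] [Fintype k] [DecidableEq k]
    {K : Matrix m m ℝ} (hK : K.PosDef) {W : Matrix m k ℝ} (hW : Function.Injective W.mulVec)
    (u h : m → ℝ) {s t : k → ℝ} (ht : t = -((Wᵀ * K * W)⁻¹ *ᵥ (Wᵀ *ᵥ (K *ᵥ u + h))))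
    (hst : s ≠ t) :
    (u + W *ᵥ t) ⬝ᵥ K *ᵥ (u + W *ᵥ t) + 2 * ((u + W *ᵥ t) ⬝ᵥ h) <
      (u + W *ᵥ s) ⬝ᵥ K *ᵥ (u + W *ᵥ s) + 2 * ((u + W *ᵥ s) ⬝ᵥ h) := by
  have hH : IsUnit (Wᵀ * K * W).det := by
    have := (hK.conjTranspose_mul_mul_same hW).isUnit
    rwa [conjTranspose_eq_transpose_of_trivial, isUnit_iff_isUnit_det] at this
  have hgrad : Wᵀ *ᵥ (K *ᵥ (u + W *ᵥ t) + h) = 0 := by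
    have hHt : (Wᵀ * K * W) *ᵥ t = -(Wᵀ *ᵥ (K *ᵥ u + h)) := by
      rw [ht, mulVec_neg, mulVec_mulVec, mul_nonsing_inv _ hH, one_mulVec]
    rw [← mulVec_mulVec, ← mulVec_mulVec] at hHt
    rw [mulVec_add K, add_right_comm, mulVec_add, hHt, add_neg_cancel]
  have hd : W *ᵥ (s - t) ≠ 0 := fun h0 =>
    hst <| sub_eq_zero.1 <| hW <| h0.trans (mulVec_zero W).symm
  have hs : u + W *ᵥ s = u + W *ᵥ t + W *ᵥ (s - t) := by
    rw [mulVec_sub]; abel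
  rw [hs]
  refine hK.quadratic_lt_of_stationary hd ?_
  rw [dotProduct_comm, dotProduct_mulVec, ← mulVec_transpose, hgrad, zero_dotProduct]

end Matrix

/-- The analytical relaxed model of the OPF: with voltages determined affinely from the
generated powers via the linearized power flow (`M` invertible), `G` symmetric positive
definite and `W̃` of full column rank, the loss `P` attains a unique global minimum over
`ℝ^{2g}` at `S* = −H⁻¹·F`. -/
theorem relaxed_opf_unique_minimizer (n g : ℕ) (A : Fin n → ℂ)
    (B C : Matrix (Fin n) (Fin n) ℂ) (D : Matrix (Fin n) (Fin g) ℝ)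
    (M : Matrix (Fin n ⊕ Fin n) (Fin n ⊕ Fin n) ℝ)
    (hM : M = Matrix.fromBlocks
      (B.map Complex.re + C.map Complex.re) (B.map Complex.im - C.map Complex.im)
      (B.map Complex.im + C.map Complex.im) (-(B.map Complex.re) + C.map Complex.re))
    (hMinv : IsUnit M.det)
    (U : Fin n ⊕ Fin n → ℝ)
    (hU : U = M⁻¹.mulVec (Sum.elim (fun k => -(A k).re) (fun k => -(A k).im)))
    (W : Matrix (Fin n ⊕ Fin n) (Fin g ⊕ Fin g) ℝ)
    (hW : W = M⁻¹ * Matrix.fromBlocks (-D) 0 0 D)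
    (G : Matrix (Fin n) (Fin n) ℝ) (hG : G.PosDef) (g0 : Fin n → ℝ)
    (hWrank : ∀ x : Fin g ⊕ Fin g → ℝ, W.mulVec x = 0 → x = 0)
    (P : (Fin g ⊕ Fin g → ℝ) → ℝ)
    (hP : P = fun S =>
      (fun k => (U + W.mulVec S) (Sum.inl k)) ⬝ᵥ
          G.mulVec (fun k => (U + W.mulVec S) (Sum.inl k))
        + (fun k => (U + W.mulVec S) (Sum.inr k)) ⬝ᵥ
          G.mulVec (fun k => (U + W.mulVec S) (Sum.inr k))
        + 2 * ((fun k => (U + W.mulVec S) (Sum.inl k)) ⬝ᵥ g0))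
    (H : Matrix (Fin g ⊕ Fin g) (Fin g ⊕ Fin g) ℝ)
    (hH : H = W.transpose * Matrix.fromBlocks G 0 0 G * W)
    (F : Fin g ⊕ Fin g → ℝ)
    (hF : F = Sum.elim
      ((Matrix.toBlocks₁₁ W).transpose.mulVec (G.mulVec (fun k => U (Sum.inl k)))
        + (Matrix.toBlocks₂₁ W).transpose.mulVec (G.mulVec (fun k => U (Sum.inr k)))
        + (Matrix.toBlocks₁₁ W).transpose.mulVec g0)
      ((Matrix.toBlocks₁₂ W).transpose.mulVec (G.mulVec (fun k => U (Sum.inl k)))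
        + (Matrix.toBlocks₂₂ W).transpose.mulVec (G.mulVec (fun k => U (Sum.inr k)))
        + (Matrix.toBlocks₁₂ W).transpose.mulVec g0)) :
    ∀ S : Fin g ⊕ Fin g → ℝ, S ≠ -(H⁻¹.mulVec F) → P S > P (-(H⁻¹.mulVec F)) := by
  intro S hS
  have hWinj : Function.Injective W.mulVec := fun x y hxy =>
    sub_eq_zero.1 <| hWrank _ <| by rw [Matrix.mulVec_sub, sub_eq_zero]; exact hxy
  have hP' : ∀ S, P S = (U + W *ᵥ S) ⬝ᵥ Matrix.fromBlocks G 0 0 G *ᵥ (U + W *ᵥ S) +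
      2 * ((U + W *ᵥ S) ⬝ᵥ Sum.elim g0 0) := fun S => by
    rw [hP, Matrix.fromBlocks_mulVec, Matrix.dotProduct_block, Matrix.dotProduct_block]
    simp [Function.comp_def]
  have hF' : F = Wᵀ *ᵥ (Matrix.fromBlocks G 0 0 G *ᵥ U + Sum.elim g0 0) := by
    rw [hF]
    conv_rhs => rw [← Matrix.fromBlocks_toBlocks W, Matrix.fromBlocks_transpose,
      Matrix.fromBlocks_mulVec, Matrix.fromBlocks_mulVec]
    ext (i | i) <;>
      simp [Function.comp_def, ← Pi.add_def, Matrix.mulVec_add] <;> ring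
  rw [gt_iff_lt, hP', hP']
  exact (hG.fromBlocks_diagonal hG).quadratic_comp_affine_lt hWinj U _ (by rw [hH, hF']) hS
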